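/- Suppose the one-dimensional kinetic Fokker–Planck equation ∂_t f + v ∂_x f = ∂_v(σ ∂_v f + β v f) on (0,T)×(−1,1)×ℝ, with diffusion coefficient σ > 0 and friction coefficient β ≥ 0, initial datum f(0,x,v) = f₀(x,v), and specular reflection boundary condition f(t,x,v) = f(t,x,−v) at x = ±1, admits a solution f whose restriction to K = [0,T]×[−1,1]×V, V = [−10,10], extends to a function of class C^{(1,1,2)} (all partial derivatives ∂_t^a ∂_x^b ∂_v^c with a ≤ 1, b ≤ 1, c ≤ 2 exist and are continuous) on an open neighborhood of K. Let σ̄ ∈ C³(ℝ) be any non-polynomial function. Then there exists a sequence (f_j) of one-hidden-layer neural networks, f_j(t,x,v) = Σ_{i=1}^{m_j} c_{j,i} σ̄(w_{j,i}·(t,x,v) + θ_{j,i}) with c_{j,i}, θ_{j,i} ∈ ℝ and w_{j,i} ∈ ℝ³, such that Loss_GE(f_j) + Loss_IC(f_j) + Loss_BC^{sp}(f_j) → 0 as j → ∞. -/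

import Mathlib

open Real MeasureTheory Set Filter

/-- Partial derivative in the time variable. -/
noncomputable def Dt (f : ℝ → ℝ → ℝ → ℝ) : ℝ → ℝ → ℝ → ℝ :=
  fun t x v => deriv (fun s => f s x v) t

/-- Partial derivative in the space variable. -/
noncomputable def Dx (f : ℝ → ℝ → ℝ → ℝ) : ℝ → ℝ → ℝ → ℝ :=
  fun t x v => deriv (fun y => f t y v) x

/-- Partial derivative in the velocity variable. -/
noncomputable def Dv (f : ℝ → ℝ → ℝ → ℝ) : ℝ → ℝ → ℝ → ℝ :=
  fun t x v => deriv (fun w => f t x w) v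

/-- Mixed partial derivative ∂_t^a ∂_x^b ∂_v^c. -/
noncomputable def mixedD (a b c : ℕ) (f : ℝ → ℝ → ℝ → ℝ) : ℝ → ℝ → ℝ → ℝ :=
  Dt^[a] (Dx^[b] (Dv^[c] f))

/-- `f` is of class C^{(1,1,2)} on `U`: all mixed partial derivatives
∂_t^a ∂_x^b ∂_v^c with a ≤ 1, b ≤ 1, c ≤ 2 exist and are continuous on `U`. -/
def IsC112On (f : ℝ → ℝ → ℝ → ℝ) (U : Set (ℝ × ℝ × ℝ)) : Prop :=
  (∀ a b c : ℕ, a ≤ 1 → b ≤ 1 → c ≤ 2 → ∀ p ∈ U,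
    ContinuousAt (fun q : ℝ × ℝ × ℝ => mixedD a b c f q.1 q.2.1 q.2.2) p) ∧
  (∀ b c : ℕ, b ≤ 1 → c ≤ 2 → ∀ p ∈ U,
    DifferentiableAt ℝ (fun s => mixedD 0 b c f s p.2.1 p.2.2) p.1) ∧
  (∀ c : ℕ, c ≤ 2 → ∀ p ∈ U,
    DifferentiableAt ℝ (fun y => mixedD 0 0 c f p.1 y p.2.2) p.2.1) ∧
  (∀ c : ℕ, c ≤ 1 → ∀ p ∈ U,
    DifferentiableAt ℝ (fun w => mixedD 0 0 c f p.1 p.2.1 w) p.2.2)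

/-- The compact set K = [0,T] × [−1,1] × V with V = [−10,10]. -/
def Kset (T : ℝ) : Set (ℝ × ℝ × ℝ) :=
  Set.Icc (0 : ℝ) T ×ˢ Set.Icc (-1 : ℝ) 1 ×ˢ Set.Icc (-10 : ℝ) 10

/-- The Fokker–Planck residual ∂_t u + v ∂_x u − σ ∂_{vv} u − β ∂_v(v u). -/
noncomputable def FPresidual (σ β : ℝ) (u : ℝ → ℝ → ℝ → ℝ) : ℝ → ℝ → ℝ → ℝ :=
  fun t x v => Dt u t x v + v * Dx u t x v - σ * Dv (Dv u) t x v
    - β * Dv (fun t' x' w => w * u t' x' w) t x v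

/-- Loss for the governing equation. -/
noncomputable def LossGE (σ β T : ℝ) (u : ℝ → ℝ → ℝ → ℝ) : ℝ :=
  ∫ t in (0 : ℝ)..T, ∫ x in (-1 : ℝ)..(1 : ℝ), ∫ v in (-10 : ℝ)..(10 : ℝ),
    (FPresidual σ β u t x v) ^ 2

/-- Loss for the initial condition. -/
noncomputable def LossIC (f0 : ℝ → ℝ → ℝ) (u : ℝ → ℝ → ℝ → ℝ) : ℝ :=
  ∫ x in (-1 : ℝ)..(1 : ℝ), ∫ v in (-10 : ℝ)..(10 : ℝ), (u 0 x v - f0 x v) ^ 2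


/-- Loss for the specular reflection boundary condition. -/
noncomputable def LossBCspec (T : ℝ) (u : ℝ → ℝ → ℝ → ℝ) : ℝ :=
  ∫ t in (0 : ℝ)..T,
    ((∫ v in (-10 : ℝ)..(0 : ℝ), (u t 1 v - u t 1 (-v)) ^ 2) +
     (∫ v in (0 : ℝ)..(10 : ℝ), (u t (-1) v - u t (-1) (-v)) ^ 2))


open Real MeasureTheory Set Filter

set_option linter.unusedSectionVars false
section A
variable {R : ℝ} {V : Type*} [NormedAddCommGroup V] [NormedSpace ℝ V] [CompleteSpace V]

/-- `F` restricted to `[-R,R]` belongs to `M`. -/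
def App (M : Submodule ℝ C(Icc (-R) R, V)) (F : ℝ → V) : Prop :=
  ∃ e ∈ M, ∀ s : Icc (-R) R, e s = F s

lemma App.congr {M : Submodule ℝ C(Icc (-R) R, V)} {F G : ℝ → V} (h : App M F)
    (hFG : ∀ s, F s = G s) : App M G := by
  obtain ⟨e, he, h⟩ := h
  exact ⟨e, he, fun s => by rw [h, hFG]⟩

lemma App.smul {M : Submodule ℝ C(Icc (-R) R, V)} {F : ℝ → V} (h : App M F) (c : ℝ) :
    App M (fun s => c • F s) := by
  obtain ⟨e, he, h⟩ := h
  exact ⟨c • e, M.smul_mem c he, fun s => by simp [h]⟩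

/-- curry a jointly continuous function. -/
noncomputable def cur (R : ℝ) (F : ℝ → ℝ → V) (hF : Continuous (fun q : ℝ × ℝ => F q.1 q.2)) :
    C(ℝ, C(Icc (-R) R, V)) :=
  ContinuousMap.curry ⟨fun q : ℝ × Icc (-R) R => F q.1 q.2,
    hF.comp (continuous_fst.prodMk (continuous_subtype_val.comp continuous_snd))⟩

lemma cur_apply (F : ℝ → ℝ → V) (hF) (a : ℝ) (s : Icc (-R) R) : cur R F hF a s = F a s := rfl

lemma cur_mem {M : Submodule ℝ C(Icc (-R) R, V)} (F : ℝ → ℝ → V) (hF) (a : ℝ)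
    (h : App M (F a)) : cur R F hF a ∈ M := by
  obtain ⟨e, he, h⟩ := h
  have : cur R F hF a = e := by
    ext s; rw [cur_apply, h]
  rwa [this]

lemma ev_integral (Φ : C(ℝ, C(Icc (-R) R, V))) (a b : ℝ) (s : Icc (-R) R) :
    (∫ y in a..b, Φ y) s = ∫ y in a..b, Φ y s := by
  have := ContinuousLinearMap.intervalIntegral_comp_comm (μ := volume) (a := a) (b := b)
    (ContinuousMap.evalCLM ℝ s : C(Icc (-R) R, V) →L[ℝ] V) (f := Φ)
    (Φ.continuous.intervalIntegrable _ _)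
  simpa using this.symm

lemma int_mem {E : Type*} [NormedAddCommGroup E] [NormedSpace ℝ E] [CompleteSpace E]
    (M : Submodule ℝ E) (hM : IsClosed (M : Set E)) (Φ : ℝ → E) (hΦ : Continuous Φ)
    (h : ∀ a, Φ a ∈ M) (a b : ℝ) : ∫ y in a..b, Φ y ∈ M := by
  have : IsClosed (M : Set E) := hM
  have e := ContinuousLinearMap.intervalIntegral_comp_comm (μ := volume) (a := a) (b := b)
    (M.mkQL) (f := Φ) (hΦ.intervalIntegrable _ _)
  rw [← Submodule.Quotient.mk_eq_zero]
  change M.mkQL _ = 0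
  rw [← e]
  have : ∀ y, M.mkQL (Φ y) = 0 := fun y => (Submodule.Quotient.mk_eq_zero M).2 (h y)
  simp [this]

lemma app_integral {M : Submodule ℝ C(Icc (-R) R, V)} (hM : IsClosed (M : Set C(Icc (-R) R, V)))
    (F : ℝ → ℝ → V) (hF : Continuous (fun q : ℝ × ℝ => F q.1 q.2)) (h : ∀ a, App M (F a))
    (a b : ℝ) : App M (fun s => ∫ y in a..b, F y s) := by
  refine ⟨∫ y in a..b, cur R F hF y, int_mem M hM _ (cur R F hF).continuous
    (fun a => cur_mem F hF a (h a)) a b, fun s => ?_⟩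
  rw [ev_integral]; rfl

lemma app_deriv {M : Submodule ℝ C(Icc (-R) R, V)} (hM : IsClosed (M : Set C(Icc (-R) R, V)))
    (F F' : ℝ → ℝ → V) (hF : Continuous (fun q : ℝ × ℝ => F q.1 q.2))
    (hF' : Continuous (fun q : ℝ × ℝ => F' q.1 q.2))
    (hd : ∀ a s, HasDerivAt (fun a => F a s) (F' a s) a)
    (h : ∀ a, App M (F a)) (a : ℝ) : App M (F' a) := by
  refine ⟨cur R F' hF' a, ?_, fun s => rfl⟩
  have key : ∀ b, cur R F hF b = cur R F hF a + ∫ y in a..b, cur R F' hF' y := by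
    intro b
    ext s
    rw [ContinuousMap.add_apply, ev_integral]
    simp only [cur_apply]
    rw [intervalIntegral.integral_eq_sub_of_hasDerivAt (fun y _ => hd y s)]
    · simp
    · exact (hF'.comp (continuous_id.prodMk continuous_const)).intervalIntegrable _ _
  have hder : HasDerivAt (cur R F hF) (cur R F' hF' a) a := by
    have h1 := (cur R F' hF').continuous.integral_hasStrictDerivAt a a
    have h2 := h1.hasDerivAt.const_add (cur R F hF a)
    refine h2.congr_of_eventuallyEq (Eventually.of_forall fun b => ?_)
    exact key b
  have ht := hasDerivAt_iff_tendsto_slope.1 hder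
  refine hM.mem_of_tendsto ht (Eventually.of_forall fun b => ?_)
  rw [slope_def_module]
  exact M.smul_mem _ (M.sub_mem (cur_mem F hF b (h b)) (cur_mem F hF a (h a)))
end A

/-- box average -/
noncomputable def box (δ : ℝ) (g : ℝ → ℝ) (s : ℝ) : ℝ := ∫ y in (0:ℝ)..1, g (s + δ * y)

lemma box_eq {δ : ℝ} (hδ : δ ≠ 0) {g A : ℝ → ℝ} (hg : Continuous g)
    (hA : ∀ x, HasDerivAt A (g x) x) (s : ℝ) :
    box δ g s = δ⁻¹ * (A (s + δ) - A s) := by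
  have h : ∀ y ∈ uIcc (0:ℝ) 1, HasDerivAt (fun y => δ⁻¹ * A (s + δ * y)) (g (s + δ * y)) y := by
    intro y _
    have h1 : HasDerivAt (fun y => s + δ * y) δ y := by
      simpa using ((hasDerivAt_id y).const_mul δ).const_add s
    have h2 := ((hA (s + δ * y)).comp y h1).const_mul δ⁻¹
    refine h2.congr_deriv ?_
    rw [mul_comm (g _) δ, inv_mul_cancel_left₀ hδ]
  unfold box
  rw [intervalIntegral.integral_eq_sub_of_hasDerivAt h]
  · simp; ring
  · exact Continuous.intervalIntegrable (by fun_prop) _ _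

lemma exists_anti {g : ℝ → ℝ} (hg : Continuous g) : ∃ A : ℝ → ℝ, ∀ x, HasDerivAt A (g x) x :=
  ⟨fun x => ∫ y in (0:ℝ)..x, g y, fun x => (hg.integral_hasStrictDerivAt 0 x).hasDerivAt⟩

lemma box_contDiff {δ : ℝ} (hδ : δ ≠ 0) {g : ℝ → ℝ} {n : ℕ} (hg : ContDiff ℝ n g) :
    ContDiff ℝ (n + 1 : ℕ) (box δ g) := by
  obtain ⟨A, hA⟩ := exists_anti hg.continuous
  have hd : deriv A = g := funext fun x => (hA x).deriv
  have : ContDiff ℝ (n + 1 : ℕ) A := by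
    push_cast
    rw [contDiff_succ_iff_deriv]
    refine ⟨fun x => (hA x).differentiableAt, by simp, ?_⟩
    rw [hd]; exact hg
  have e : box δ g = fun s => δ⁻¹ * (A (s + δ) - A s) := funext (box_eq hδ hg.continuous hA)
  rw [e]
  exact contDiff_const.mul ((this.comp (contDiff_id.add contDiff_const)).sub this)

lemma box_deriv {δ : ℝ} (hδ : δ ≠ 0) {g : ℝ → ℝ} (hg : ContDiff ℝ 1 g) :
    deriv (box δ g) = box δ (deriv g) := by
  obtain ⟨A, hA⟩ := exists_anti hg.continuous
  have e : box δ g = fun s => δ⁻¹ * (A (s + δ) - A s) := funext (box_eq hδ hg.continuous hA)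
  funext s
  rw [box_eq hδ (hg.continuous_deriv le_rfl)
    (fun x => ((hg.differentiable (by norm_num)) x).hasDerivAt), e]
  refine HasDerivAt.deriv ?_
  refine HasDerivAt.const_mul _ (HasDerivAt.sub ?_ (hA s))
  exact HasDerivAt.comp_add_const s δ (hA (s + δ))

lemma box_bound {δ : ℝ} (hδ : 0 < δ) {g : ℝ → ℝ} (hg : Continuous g) {a b c ε : ℝ}
    (h : ∀ y ∈ Icc a b, |g y - c| ≤ ε) : ∀ y ∈ Icc a (b - δ), |box δ g y - c| ≤ ε := by
  intro y hy
  have : box δ g y - c = ∫ z in (0:ℝ)..1, (g (y + δ * z) - c) := by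
    rw [intervalIntegral.integral_sub]
    · simp [box]
    · exact Continuous.intervalIntegrable (by fun_prop) _ _
    · exact Continuous.intervalIntegrable (by fun_prop) _ _
  rw [this]
  have := intervalIntegral.norm_integral_le_of_norm_le_const (a := (0:ℝ)) (b := 1) (C := ε)
    (f := fun z => g (y + δ * z) - c) (by
      intro z hz
      rw [uIoc_of_le zero_le_one] at hz
      refine h _ ⟨?_, ?_⟩
      · nlinarith [hy.1, hz.1]
      · nlinarith [hy.2, hz.2])
  simpa using this

/-- jets -/
noncomputable def jet (g : ℝ → ℝ) (l θ s : ℝ) : ℝ × ℝ × ℝ :=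
  (g (l * s + θ), l * deriv g (l * s + θ), l ^ 2 * deriv (deriv g) (l * s + θ))

lemma c2_facts {g : ℝ → ℝ} (hg : ContDiff ℝ 2 g) :
    ContDiff ℝ 1 (deriv g) ∧ Continuous g ∧ Continuous (deriv g) ∧ Continuous (deriv (deriv g)) := by
  have h1 : ContDiff ℝ 1 (deriv g) := by
    have : ContDiff ℝ (1 + 1) g := by norm_num; exact hg
    exact (contDiff_succ_iff_deriv.1 this).2.2
  exact ⟨h1, hg.continuous, h1.continuous, h1.continuous_deriv le_rfl⟩

lemma jet_box {R : ℝ} {M : Submodule ℝ C(Icc (-R) R, ℝ × ℝ × ℝ)}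
    (hM : IsClosed (M : Set C(Icc (-R) R, ℝ × ℝ × ℝ))) {δ : ℝ} (hδ : δ ≠ 0) {g : ℝ → ℝ}
    (hg : ContDiff ℝ 2 g) (h : ∀ l θ, App M (jet g l θ)) (l θ : ℝ) :
    App M (jet (box δ g) l θ) := by
  obtain ⟨h1, c0, c1, c2⟩ := c2_facts hg
  have := app_integral hM (fun y s => jet g l (θ + δ * y) s)
    (by unfold jet; fun_prop) (fun a => h l _) 0 1
  refine this.congr fun s => ?_
  have hc : Continuous (fun y => jet g l (θ + δ * y) s) := by unfold jet; fun_prop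
  have hi := hc.intervalIntegrable (μ := volume) 0 1
  have e1 := (ContinuousLinearMap.fst ℝ ℝ (ℝ × ℝ)).intervalIntegral_comp_comm hi
  have e2 := ((ContinuousLinearMap.fst ℝ ℝ ℝ).comp
    (ContinuousLinearMap.snd ℝ ℝ (ℝ × ℝ))).intervalIntegral_comp_comm hi
  have e3 := ((ContinuousLinearMap.snd ℝ ℝ ℝ).comp
    (ContinuousLinearMap.snd ℝ ℝ (ℝ × ℝ))).intervalIntegral_comp_comm hi
  simp only [ContinuousLinearMap.comp_apply, ContinuousLinearMap.coe_fst',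
    ContinuousLinearMap.coe_snd'] at e1 e2 e3
  refine Prod.ext ?_ (Prod.ext ?_ ?_)
  · rw [← e1]; simp only [jet, box, add_assoc]
  · rw [← e2]; simp only [jet, box_deriv hδ (hg.of_le (by norm_num))]
    simp only [box, intervalIntegral.integral_const_mul, add_assoc]
  · rw [← e3]; simp only [jet, box_deriv hδ (hg.of_le (by norm_num)), box_deriv hδ h1]
    simp only [box, intervalIntegral.integral_const_mul, add_assoc]


open Real MeasureTheory Set Filter

lemma poly_of_iteratedDeriv (n : ℕ) : ∀ g : ℝ → ℝ, ContDiff ℝ n g → (∀ x, iteratedDeriv n g x = 0) →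
    ∃ p : Polynomial ℝ, p.degree < n ∧ ∀ x, g x = p.eval x := by
  induction n with
  | zero =>
    intro g _ h
    exact ⟨0, by simp, fun x => by simpa using h x⟩
  | succ n ih =>
    intro g hg h
    have hg' : ContDiff ℝ (n + 1) g := by exact_mod_cast hg
    obtain ⟨hd, -, hc⟩ := contDiff_succ_iff_deriv.1 hg'
    obtain ⟨p, hp, he⟩ := ih (deriv g) hc (fun x => by rw [← iteratedDeriv_succ']; exact h x)
    let q : Polynomial ℝ := ∑ i ∈ Finset.range n, Polynomial.monomial (i+1) (p.coeff i / (i+1))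
    have hq : q.derivative = p := by
      have : p = ∑ i ∈ Finset.range n, Polynomial.monomial i (p.coeff i) := by
        ext k
        simp only [Polynomial.finsetSum_coeff, Polynomial.coeff_monomial]
        rw [Finset.sum_ite_eq' (Finset.range n) k]
        split_ifs with hk
        · rfl
        · exact Polynomial.coeff_eq_zero_of_degree_lt (hp.trans_le (by simpa using hk))
      conv_rhs => rw [this]
      simp only [q, Polynomial.derivative_sum]
      refine Finset.sum_congr rfl fun i _ => ?_
      rw [Polynomial.derivative_monomial]
      have : (i : ℝ) + 1 ≠ 0 := by positivity
      simp [div_mul_cancel₀ _ this]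
    have hqd : q.degree < (n + 1 : ℕ) := by
      refine (Polynomial.degree_sum_le _ _).trans_lt ?_
      rw [Finset.sup_lt_iff (by exact_mod_cast WithBot.bot_lt_coe _)]
      intro i hi
      refine (Polynomial.degree_monomial_le _ _).trans_lt ?_
      have := Finset.mem_range.1 hi
      exact_mod_cast (by omega : i + 1 < n + 1)
    have hconst : ∀ x, g x - q.eval x = g 0 - q.eval 0 := by
      intro x
      refine is_const_of_deriv_eq_zero (f := fun x => g x - q.eval x) (hd.sub q.differentiable)
        (fun y => ?_) x 0
      have := ((hd y).hasDerivAt.sub (q.hasDerivAt y)).deriv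
      have h2 : deriv (fun x => g x - q.eval x) y = deriv g y - Polynomial.eval y q.derivative := this
      rw [h2, hq, he y]; simp
    refine ⟨q + Polynomial.C (g 0 - q.eval 0), ?_, fun x => ?_⟩
    · refine (Polynomial.degree_add_le _ _).trans_lt (max_lt hqd ?_)
      refine Polynomial.degree_C_le.trans_lt ?_
      exact_mod_cast Nat.succ_pos n
    · have := hconst x
      simp; linarith

lemma poly_limit (n : ℕ) (p : ℕ → Polynomial ℝ) (hp : ∀ k, (p k).degree < n) (g : ℝ → ℝ)
    (h : ∀ x, Tendsto (fun k => (p k).eval x) atTop (nhds (g x))) :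
    ∃ q : Polynomial ℝ, ∀ x, g x = q.eval x := by
  have hv : Set.InjOn (fun i : ℕ => (i : ℝ)) (Finset.range n) := fun a _ b _ hab => by
    exact Nat.cast_injective hab
  refine ⟨Lagrange.interpolate (Finset.range n) (fun i : ℕ => (i:ℝ)) (fun i : ℕ => g i), fun x => ?_⟩
  refine tendsto_nhds_unique (h x) ?_
  have : ∀ k, (p k).eval x = ∑ i ∈ Finset.range n, (p k).eval (i : ℝ) *
      (Lagrange.basis (Finset.range n) (fun i : ℕ => (i:ℝ)) i).eval x := by
    intro k
    conv_lhs => rw [Lagrange.eq_interpolate (f := p k) hv (by simpa using hp k)]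
    simp [Lagrange.interpolate_apply, Polynomial.eval_finsetSum]
  simp_rw [this]
  simp only [Lagrange.interpolate_apply, Polynomial.eval_finsetSum, Polynomial.eval_mul,
    Polynomial.eval_C]
  exact tendsto_finsetSum _ fun i _ => (h i).mul_const _

lemma iter_box_contDiff {δ : ℝ} (hδ : δ ≠ 0) {g : ℝ → ℝ} {m : ℕ} (hg : ContDiff ℝ m g) (n : ℕ) :
    ContDiff ℝ (m + n : ℕ) ((box δ)^[n] g) := by
  induction n with
  | zero => simpa using hg
  | succ n ih =>
    rw [Function.iterate_succ_apply']
    exact box_contDiff hδ ih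

lemma iter_box_bound {δ : ℝ} (hδ : 0 < δ) {g : ℝ → ℝ} (hg : Continuous g) {a b c ε : ℝ}
    (h : ∀ y ∈ Icc a b, |g y - c| ≤ ε) (n : ℕ) :
    ∀ y ∈ Icc a (b - n * δ), |(box δ)^[n] g y - c| ≤ ε := by
  induction n with
  | zero => simpa using h
  | succ n ih =>
    rw [Function.iterate_succ_apply']
    have hc : Continuous ((box δ)^[n] g) :=
      (iter_box_contDiff hδ.ne' (m := 0) (contDiff_zero.2 hg) n).continuous
    have := box_bound hδ hc ih
    intro y hy
    refine this y ?_
    convert hy using 2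
    push_cast; ring

lemma exists_nonzero {g : ℝ → ℝ} {m : ℕ} (hg : ContDiff ℝ m g)
    (hn : ¬ ∃ p : Polynomial ℝ, ∀ y : ℝ, g y = Polynomial.eval y p) (n : ℕ) :
    ∃ δ > 0, ∃ θ, iteratedDeriv n ((box δ)^[n] g) θ ≠ 0 := by
  by_contra! hcon
  apply hn
  have hδ : ∀ k : ℕ, (0:ℝ) < 1 / (k + 1) := fun k => by positivity
  have hp : ∀ k : ℕ, ∃ p : Polynomial ℝ, p.degree < n ∧
      ∀ x, (box (1 / ((k:ℝ) + 1)))^[n] g x = p.eval x := fun k =>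
    poly_of_iteratedDeriv n _ ((iter_box_contDiff (hδ k).ne' hg n).of_le
      (by exact_mod_cast Nat.le_add_left n m)) (hcon _ (hδ k))
  choose p hp1 hp2 using hp
  refine poly_limit n p hp1 g fun x => ?_
  simp_rw [← hp2]
  rw [Metric.tendsto_atTop]
  intro ε hε
  obtain ⟨η, hη, hc⟩ := Metric.continuous_iff.1 hg.continuous x (ε / 2) (by positivity)
  obtain ⟨N, hN⟩ := exists_nat_gt (2 * (n:ℝ) / η)
  refine ⟨N, fun k hk => ?_⟩
  have hb := iter_box_bound (hδ k) hg.continuous (a := x) (b := x + η / 2) (c := g x) (ε := ε/2)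
    (fun y hy => by
      have := hc y (by rw [Real.dist_eq, abs_lt]; constructor <;> linarith [hy.1, hy.2])
      rw [Real.dist_eq] at this; exact this.le) n x ⟨le_rfl, ?_⟩
  · rw [Real.dist_eq]; linarith
  · have hk' : (N:ℝ) ≤ k := by exact_mod_cast hk
    rw [div_lt_iff₀ hη] at hN
    have : (n:ℝ) * (1 / ((k:ℝ)+1)) ≤ η / 2 := by
      rw [mul_one_div, div_le_iff₀ (by positivity)]
      nlinarith
    linarith

/-- The jet of `s ^ k * g⁽ᵏ⁾ (l * s + θ)`. -/
noncomputable def pjet (g : ℝ → ℝ) (k : ℕ) (l θ s : ℝ) : ℝ × ℝ × ℝ :=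
  (s ^ k * iteratedDeriv k g (l * s + θ),
   k * s ^ (k - 1) * iteratedDeriv k g (l * s + θ)
     + l * s ^ k * iteratedDeriv (k + 1) g (l * s + θ),
   k * (k - 1 : ℕ) * s ^ (k - 2) * iteratedDeriv k g (l * s + θ)
     + 2 * l * k * s ^ (k - 1) * iteratedDeriv (k + 1) g (l * s + θ)
     + l ^ 2 * s ^ k * iteratedDeriv (k + 2) g (l * s + θ))

lemma pjet_mem {R : ℝ} {M : Submodule ℝ C(Icc (-R) R, ℝ × ℝ × ℝ)}
    (hM : IsClosed (M : Set C(Icc (-R) R, ℝ × ℝ × ℝ))) {g : ℝ → ℝ} {n : ℕ}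
    (hg : ContDiff ℝ (n + 2 : ℕ) g) (h : ∀ l θ, App M (jet g l θ)) :
    ∀ k ≤ n, ∀ l θ, App M (pjet g k l θ) := by
  have hc : ∀ i ≤ n + 2, Continuous (iteratedDeriv i g) := fun i hi =>
    hg.continuous_iteratedDeriv i (by exact_mod_cast hi)
  have hd : ∀ i < n + 2, ∀ x, HasDerivAt (iteratedDeriv i g) (iteratedDeriv (i+1) g x) x := by
    intro i hi x
    rw [iteratedDeriv_succ]
    exact ((hg.differentiable_iteratedDeriv i (by exact_mod_cast hi)) x).hasDerivAt
  have hcont : ∀ k ≤ n, ∀ θ, Continuous (fun q : ℝ × ℝ => pjet g k q.1 θ q.2) := by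
    intro k hk θ
    have c0 := hc k (by omega)
    have c1 := hc (k+1) (by omega)
    have c2 := hc (k+2) (by omega)
    unfold pjet; fun_prop
  intro k
  induction k with
  | zero =>
    intro _ l θ
    refine (h l θ).congr fun s => ?_
    simp [pjet, jet, iteratedDeriv_succ, iteratedDeriv_zero]
  | succ k ih =>
    intro hk l θ
    refine app_deriv hM (fun l s => pjet g k l θ s) (fun l s => pjet g (k+1) l θ s)
      (hcont k (by omega) θ) (hcont (k+1) hk θ) ?_ (fun l => ih (by omega) l θ) l
    intro l s
    have hin : HasDerivAt (fun l => l * s + θ) s l := by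
      simpa using ((hasDerivAt_id l).mul_const s).add_const θ
    have d0 := (hd k (by omega) (l*s+θ)).comp l hin
    have d1 := (hd (k+1) (by omega) (l*s+θ)).comp l hin
    have d2 := (hd (k+2) (by omega) (l*s+θ)).comp l hin
    have hl := hasDerivAt_id l
    refine HasDerivAt.prodMk ?_ (HasDerivAt.prodMk ?_ ?_)
    · refine (d0.const_mul (s^k)).congr_deriv ?_
      ring
    · refine ((d0.const_mul (k * s^(k-1))).add ((hl.mul_const (s^k)).mul d1)).congr_deriv ?_
      simp only [Function.comp_apply, id]
      rcases k with _ | k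
      · simp; ring
      · simp; ring
    · refine (((d0.const_mul (k * (k-1:ℕ) * s^(k-2))).add
        ((((hl.const_mul 2).mul_const (k:ℝ)).mul_const (s^(k-1))).mul d1)).add
        (((hl.pow 2).mul_const (s^k)).mul d2)).congr_deriv ?_
      simp only [Function.comp_apply, id]
      rcases k with _ | _ | k
      · simp; ring
      · simp; ring
      · simp; ring

lemma monomial_mem {R : ℝ} {M : Submodule ℝ C(Icc (-R) R, ℝ × ℝ × ℝ)}
    (hM : IsClosed (M : Set C(Icc (-R) R, ℝ × ℝ × ℝ))) {g : ℝ → ℝ}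
    (hg : ContDiff ℝ 2 g) (hn : ¬ ∃ p : Polynomial ℝ, ∀ y : ℝ, g y = Polynomial.eval y p)
    (h : ∀ l θ, App M (jet g l θ)) (n : ℕ) :
    App M (fun s => (s ^ n, n * s ^ (n-1), n * (n - 1 : ℕ) * s ^ (n - 2))) := by
  have hg' : ContDiff ℝ (2:ℕ) g := by exact_mod_cast hg
  obtain ⟨δ, hδ, θ, hne⟩ := exists_nonzero hg' hn n
  have hb : ∀ k l θ, App M (jet ((box δ)^[k] g) l θ) := by
    intro k
    induction k with
    | zero => simpa using h
    | succ k ih =>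
      rw [Function.iterate_succ_apply']
      refine jet_box hM hδ.ne' ((iter_box_contDiff hδ.ne' hg' k).of_le ?_) ih
      exact_mod_cast Nat.le_add_right 2 k
  have := pjet_mem hM (n := n) (by rw [add_comm]; exact iter_box_contDiff hδ.ne' hg' n)
    (hb n) n le_rfl 0 θ
  refine (this.smul (iteratedDeriv n ((box δ)^[n] g) θ)⁻¹).congr fun s => ?_
  simp only [pjet]
  refine Prod.ext ?_ (Prod.ext ?_ ?_)
  · simp; field_simp
  · simp; field_simp
  · simp; field_simp


open Real MeasureTheory Set Filter

lemma oneD {g : ℝ → ℝ}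
    (hg : ContDiff ℝ 2 g) (hn : ¬ ∃ p : Polynomial ℝ, ∀ y : ℝ, g y = Polynomial.eval y p)
    (R : ℝ) (n : ℕ) (ε : ℝ) (hε : 0 < ε) :
    ∃ (m : ℕ) (c l θ : Fin m → ℝ), ∀ s ∈ Icc (-R) R,
      |∑ i, c i * g (l i * s + θ i) - s ^ n| ≤ ε ∧
      |∑ i, c i * (l i * deriv g (l i * s + θ i)) - n * s ^ (n-1)| ≤ ε ∧
      |∑ i, c i * (l i ^ 2 * deriv (deriv g) (l i * s + θ i)) - n * (n-1:ℕ) * s ^ (n-2)| ≤ ε := by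
  obtain ⟨h1, c0, c1, c2⟩ := c2_facts hg
  let τ : ℝ × ℝ → C(Icc (-R) R, ℝ × ℝ × ℝ) := fun q =>
    ⟨fun s => jet g q.1 q.2 s, by unfold jet; fun_prop⟩
  let M := (Submodule.span ℝ (range τ)).topologicalClosure
  have hM : IsClosed (M : Set C(Icc (-R) R, ℝ × ℝ × ℝ)) :=
    Submodule.isClosed_topologicalClosure _
  obtain ⟨e, he, hes⟩ := monomial_mem hM hg hn (fun l θ =>
    ⟨τ (l, θ), Submodule.le_topologicalClosure _ (Submodule.subset_span ⟨_, rfl⟩), fun s => rfl⟩) n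
  have he' : e ∈ closure (Submodule.span ℝ (range τ) : Set C(Icc (-R) R, ℝ × ℝ × ℝ)) := he
  obtain ⟨u, hu, hue⟩ := Metric.mem_closure_iff.1 he' ε hε
  obtain ⟨m, c, q, hq⟩ := (Submodule.mem_span_set' (R := ℝ)).1 hu
  choose r hr using fun i => (q i).2
  refine ⟨m, c, fun i => (r i).1, fun i => (r i).2, fun s hs => ?_⟩
  have hd := (ContinuousMap.dist_lt_iff hε).1 hue ⟨s, hs⟩
  rw [hes] at hd
  have hus : u ⟨s, hs⟩ = ∑ i, c i • jet g (r i).1 (r i).2 s := by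
    rw [← hq, ContinuousMap.coe_sum, Finset.sum_apply]
    refine Finset.sum_congr rfl fun i _ => ?_
    rw [← hr i]; rfl
  rw [hus, dist_comm, Prod.dist_eq, Prod.dist_eq, max_lt_iff, max_lt_iff] at hd
  simp only [Real.dist_eq, Prod.fst_sum, Prod.snd_sum, Prod.smul_fst, Prod.smul_snd, jet,
    smul_eq_mul] at hd
  exact ⟨hd.1.le, hd.2.1.le, hd.2.2.le⟩

/-- jet of a neuron -/
noncomputable def nj (g : ℝ → ℝ) (q : (Fin 3 → ℝ) × ℝ) (p : Fin 3 → ℝ) : Fin 5 → ℝ :=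
  ![g (q.1 0 * p 0 + q.1 1 * p 1 + q.1 2 * p 2 + q.2),
    q.1 0 * deriv g (q.1 0 * p 0 + q.1 1 * p 1 + q.1 2 * p 2 + q.2),
    q.1 1 * deriv g (q.1 0 * p 0 + q.1 1 * p 1 + q.1 2 * p 2 + q.2),
    q.1 2 * deriv g (q.1 0 * p 0 + q.1 1 * p 1 + q.1 2 * p 2 + q.2),
    q.1 2 ^ 2 * deriv (deriv g) (q.1 0 * p 0 + q.1 1 * p 1 + q.1 2 * p 2 + q.2)]

/-- jet of a polynomial -/
noncomputable def pj (P : MvPolynomial (Fin 3) ℝ) (p : Fin 3 → ℝ) : Fin 5 → ℝ :=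
  ![MvPolynomial.eval p P, MvPolynomial.eval p (MvPolynomial.pderiv 0 P),
    MvPolynomial.eval p (MvPolynomial.pderiv 1 P), MvPolynomial.eval p (MvPolynomial.pderiv 2 P),
    MvPolynomial.eval p (MvPolynomial.pderiv 2 (MvPolynomial.pderiv 2 P))]

lemma pj_add (P Q) (p) : pj (P + Q) p = pj P p + pj Q p := by
  simp [pj]

lemma pj_smul (c : ℝ) (Q) (p) : pj (c • Q) p = c • pj Q p := by
  simp [pj]

/-- polynomials approximable on `K` -/
def LL (g : ℝ → ℝ) (K : Set (Fin 3 → ℝ)) : Submodule ℝ (MvPolynomial (Fin 3) ℝ) where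
  carrier := {P | ∀ ε > 0, ∃ N ∈ Submodule.span ℝ (range (nj g)), ∀ p ∈ K, ∀ i,
    |N p i - pj P p i| ≤ ε}
  add_mem' := by
    intro P Q hP hQ ε hε
    obtain ⟨N, hN, h1⟩ := hP (ε/2) (by positivity)
    obtain ⟨N', hN', h2⟩ := hQ (ε/2) (by positivity)
    refine ⟨N + N', add_mem hN hN', fun p hp i => ?_⟩
    rw [pj_add]
    have a := abs_le.1 (h1 p hp i)
    have b := abs_le.1 (h2 p hp i)
    simp only [Pi.add_apply]
    rw [abs_le]; constructor <;> linarith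
  zero_mem' := by
    intro ε hε
    refine ⟨0, zero_mem _, fun p hp i => ?_⟩
    have : pj 0 p = 0 := by simpa using pj_smul 0 0 p
    rw [this]; simpa using hε.le
  smul_mem' := by
    intro c P hP ε hε
    obtain ⟨N, hN, h1⟩ := hP (ε/(|c|+1)) (by positivity)
    refine ⟨c • N, Submodule.smul_mem _ c hN, fun p hp i => ?_⟩
    rw [pj_smul]
    simp only [Pi.smul_apply, smul_eq_mul]
    rw [← mul_sub, abs_mul]
    have := h1 p hp i
    rw [le_div_iff₀ (by positivity)] at this
    nlinarith [abs_nonneg (N p i - pj P p i)]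

lemma ridge_pj (w : Fin 3 → ℝ) (n : ℕ) (p : Fin 3 → ℝ) (s : ℝ)
    (hs : s = w 0 * p 0 + w 1 * p 1 + w 2 * p 2) :
    pj ((w 0 • MvPolynomial.X 0 + w 1 • MvPolynomial.X 1 + w 2 • MvPolynomial.X 2) ^ n) p =
    ![s ^ n, w 0 * (n * s ^ (n-1)), w 1 * (n * s ^ (n-1)), w 2 * (n * s ^ (n-1)),
      w 2 ^ 2 * (n * (n-1:ℕ) * s ^ (n-2))] := by
  subst hs
  have hd : ∀ (i : Fin 3) (k : ℕ), MvPolynomial.pderiv i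
    ((w 0 • MvPolynomial.X 0 + w 1 • MvPolynomial.X 1 + w 2 • MvPolynomial.X 2 :
      MvPolynomial (Fin 3) ℝ) ^ k) = (k * w i : ℝ) •
      (w 0 • MvPolynomial.X 0 + w 1 • MvPolynomial.X 1 + w 2 • MvPolynomial.X 2) ^ (k-1) := by
    intro i k
    rw [Derivation.leibniz_pow]
    have : MvPolynomial.pderiv i (w 0 • MvPolynomial.X 0 + w 1 • MvPolynomial.X 1 +
      w 2 • MvPolynomial.X 2 : MvPolynomial (Fin 3) ℝ) = MvPolynomial.C (w i) := by
      fin_cases i <;> simp [MvPolynomial.pderiv_X, MvPolynomial.smul_eq_C_mul]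
    rw [this]
    simp only [MvPolynomial.smul_eq_C_mul, map_mul, smul_eq_mul, nsmul_eq_mul, map_natCast]
    ring
  unfold pj
  simp only [hd, Derivation.map_smul, MvPolynomial.smul_eval, map_pow, map_add,
    MvPolynomial.eval_X]
  ext i
  fin_cases i
  · simp
  · simp; ring
  · simp; ring
  · simp; ring
  · simp [Nat.sub_sub]; ring

lemma ridge_mem {g : ℝ → ℝ}
    (hg : ContDiff ℝ 2 g) (hn : ¬ ∃ p : Polynomial ℝ, ∀ y : ℝ, g y = Polynomial.eval y p)
    (K : Set (Fin 3 → ℝ)) (B : ℝ) (hK : ∀ p ∈ K, ∀ i, |p i| ≤ B) (w : Fin 3 → ℝ) (n : ℕ) :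
    ((w 0 • MvPolynomial.X 0 + w 1 • MvPolynomial.X 1 + w 2 • MvPolynomial.X 2) ^ n) ∈ LL g K := by
  intro ε hε
  set W := 1 + |w 0| + |w 1| + |w 2| + w 2 ^ 2 with hW
  have hW0 : 0 < W := by positivity
  obtain ⟨m, c, l, θ, h⟩ := oneD hg hn (W * B) n (ε / W) (by positivity)
  refine ⟨∑ i, c i • nj g (l i • w, θ i), Submodule.sum_mem _ fun i _ =>
    Submodule.smul_mem _ _ (Submodule.subset_span ⟨_, rfl⟩), fun p hp i => ?_⟩
  set s := w 0 * p 0 + w 1 * p 1 + w 2 * p 2 with hs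
  have hsB : s ∈ Icc (-(W*B)) (W*B) := by
    rw [mem_Icc, ← abs_le]
    have hB : 0 ≤ B := (abs_nonneg _).trans (hK p hp 0)
    have e : ∀ i, |w i * p i| ≤ |w i| * B := fun i => by
      rw [abs_mul]; exact mul_le_mul_of_nonneg_left (hK p hp i) (abs_nonneg _)
    calc |s| ≤ |w 0 * p 0| + |w 1 * p 1| + |w 2 * p 2| := abs_add_three _ _ _
      _ ≤ |w 0| * B + |w 1| * B + |w 2| * B := add_le_add (add_le_add (e 0) (e 1)) (e 2)
      _ ≤ W * B := by rw [hW]; nlinarith [sq_nonneg (w 2)]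
  obtain ⟨b0, b1, b2⟩ := h s hsB
  have harg : ∀ j, l j * w 0 * p 0 + l j * w 1 * p 1 + l j * w 2 * p 2 + θ j = l j * s + θ j :=
    fun j => by rw [hs]; ring
  rw [ridge_pj w n p s hs]
  have hmul : ∀ a b : ℝ, |a| ≤ W → |b| ≤ ε / W → |a * b| ≤ ε := by
    intro a b ha hb
    rw [abs_mul]
    calc |a| * |b| ≤ W * (ε / W) := mul_le_mul ha hb (abs_nonneg _) hW0.le
      _ = ε := by field_simp
  have n0 := abs_nonneg (w 0)
  have n1 := abs_nonneg (w 1)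
  have n2 := abs_nonneg (w 2)
  have n3 := sq_nonneg (w 2)
  fin_cases i
  · have := hmul 1 _ (by rw [abs_one]; linarith) b0
    convert this using 2
    simp [nj, harg, Finset.sum_apply]
  · have := hmul (w 0) _ (by linarith) b1
    convert this using 2
    simp [nj, harg, Finset.sum_apply, mul_sub, Finset.mul_sum]
    exact Finset.sum_congr rfl fun i _ => by ring
  · have := hmul (w 1) _ (by linarith) b1
    convert this using 2
    simp [nj, harg, Finset.sum_apply, mul_sub, Finset.mul_sum]
    exact Finset.sum_congr rfl fun i _ => by ring
  · have := hmul (w 2) _ (by linarith) b1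
    convert this using 2
    simp [nj, harg, Finset.sum_apply, mul_sub, Finset.mul_sum]
    exact Finset.sum_congr rfl fun i _ => by ring
  · have := hmul (w 2 ^ 2) _ (by rw [abs_of_nonneg n3]; linarith) b2
    convert this using 2
    simp [nj, harg, Finset.sum_apply, mul_sub, Finset.mul_sum]
    exact Finset.sum_congr rfl fun i _ => by ring

lemma coeff_mem {V : Type*} [AddCommGroup V] [Module ℝ V] (L : Submodule ℝ V) (n : ℕ) (v : ℕ → V)
    (h : ∀ y : ℝ, ∑ k ∈ Finset.range n, y ^ k • v k ∈ L) : ∀ k < n, v k ∈ L := by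
  intro k hk
  rw [← Submodule.Quotient.mk_eq_zero, ← Module.forall_dual_apply_eq_zero_iff ℝ]
  intro φ
  have : (∑ k ∈ Finset.range n, Polynomial.monomial k (φ (L.mkQ (v k)))) = 0 := by
    apply Polynomial.funext
    intro y
    have h1 : L.mkQ (∑ k ∈ Finset.range n, y ^ k • v k) = 0 :=
      (Submodule.Quotient.mk_eq_zero L).2 (h y)
    have h2 := congrArg φ h1
    simp only [map_sum, map_smul, map_zero, smul_eq_mul] at h2
    simp only [Polynomial.eval_finsetSum, Polynomial.eval_monomial, Polynomial.eval_zero]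
    rw [← h2]
    exact Finset.sum_congr rfl fun i _ => mul_comm _ _
  have h3 := congrArg (fun p => Polynomial.coeff p k) this
  simp only [Polynomial.finsetSum_coeff, Polynomial.coeff_monomial, Polynomial.coeff_zero] at h3
  rw [Finset.sum_ite_eq' (Finset.range n) k] at h3
  simpa [hk] using h3

lemma LL_top {g : ℝ → ℝ}
    (hg : ContDiff ℝ 2 g) (hn : ¬ ∃ p : Polynomial ℝ, ∀ y : ℝ, g y = Polynomial.eval y p)
    (K : Set (Fin 3 → ℝ)) (B : ℝ) (hK : ∀ p ∈ K, ∀ i, |p i| ≤ B) : LL g K = ⊤ := by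
  let X : Fin 3 → MvPolynomial (Fin 3) ℝ := MvPolynomial.X
  have s1 : ∀ (y : ℝ) (a c : ℕ), (X 0 + y • X 1) ^ a * X 2 ^ c ∈ LL g K := by
    intro y a c
    have := coeff_mem (LL g K) (a + c + 1)
      (fun k => ((a + c).choose k : ℝ) • ((X 0 + y • X 1) ^ (a + c - k) * X 2 ^ k)) (fun z => by
        have := ridge_mem hg hn K B hK ![1, y, z] (a + c)
        convert this using 1
        simp only [Matrix.cons_val_zero, Matrix.cons_val_one, Matrix.cons_val, one_smul]
        rw [add_comm (MvPolynomial.X 0 + y • MvPolynomial.X 1), add_pow]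
        refine Finset.sum_congr rfl fun k _ => ?_
        simp only [MvPolynomial.smul_eq_C_mul, map_pow, map_natCast, X, mul_pow]
        ring) c (by omega)
    have h0 : ((a + c).choose c : ℝ) ≠ 0 := by
      exact_mod_cast (Nat.choose_pos (Nat.le_add_left c a)).ne'
    rw [Submodule.smul_mem_iff _ h0] at this
    simpa using this
  have s2 : ∀ (a b c : ℕ), X 0 ^ a * X 1 ^ b * X 2 ^ c ∈ LL g K := by
    intro a b c
    have := coeff_mem (LL g K) (a + b + 1)
      (fun k => ((a + b).choose k : ℝ) • (X 0 ^ (a + b - k) * X 1 ^ k * X 2 ^ c)) (fun z => by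
        have := s1 z (a + b) c
        convert this using 1
        rw [add_comm (X 0), add_pow, Finset.sum_mul]
        refine Finset.sum_congr rfl fun k _ => ?_
        simp only [MvPolynomial.smul_eq_C_mul, map_pow, map_natCast, X, mul_pow]
        ring) b (by omega)
    have h0 : ((a + b).choose b : ℝ) ≠ 0 := by
      exact_mod_cast (Nat.choose_pos (Nat.le_add_left b a)).ne'
    rw [Submodule.smul_mem_iff _ h0] at this
    simpa using this
  rw [eq_top_iff]
  rintro P -
  induction P using MvPolynomial.induction_on' with
  | monomial u a =>
    have := (LL g K).smul_mem a (s2 (u 0) (u 1) (u 2))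
    convert this using 1
    rw [MvPolynomial.monomial_eq, MvPolynomial.smul_eq_C_mul, Finsupp.prod_fintype _ _ (by simp),
      Fin.prod_univ_three]
  | add p q hp hq => exact add_mem hp hq


open Real MeasureTheory Set Filter

lemma hd_poly (P : MvPolynomial (Fin 3) ℝ) (p : Fin 3 → ℝ) (i : Fin 3) (s : ℝ) :
    HasDerivAt (fun s => MvPolynomial.eval (Function.update p i s) P)
      (MvPolynomial.eval (Function.update p i s) (MvPolynomial.pderiv i P)) s := by
  induction P using MvPolynomial.induction_on with
  | C a => simpa using hasDerivAt_const s a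
  | add P Q hP hQ => simp only [map_add]; exact hP.add hQ
  | mul_X P j hP =>
    have hX : HasDerivAt (fun s => Function.update p i s j) ((Pi.single i 1 : Fin 3 → ℝ) j) s :=
      hasDerivAt_pi.1 (hasDerivAt_update p i s) j
    simp only [map_mul, MvPolynomial.eval_X, Derivation.leibniz, smul_eq_mul, map_add,
      MvPolynomial.pderiv_X]
    refine (hP.mul hX).congr_deriv ?_
    by_cases h : j = i
    · subst h; simp; ring
    · simp [h]; ring

lemma exists_antip (P : MvPolynomial (Fin 3) ℝ) (i : Fin 3) :
    ∃ Q, MvPolynomial.pderiv i Q = P := by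
  induction P using MvPolynomial.induction_on' with
  | monomial u a =>
    refine ⟨MvPolynomial.monomial (u + Finsupp.single i 1) (a / (u i + 1)), ?_⟩
    rw [MvPolynomial.pderiv_monomial]
    have : (u i : ℝ) + 1 ≠ 0 := by positivity
    simp [div_mul_cancel₀ _ this]
  | add P Q hP hQ =>
    obtain ⟨A, hA⟩ := hP
    obtain ⟨B, hB⟩ := hQ
    exact ⟨A + B, by rw [map_add, hA, hB]⟩

/-- set the variable `i` to zero -/
noncomputable def rst (i : Fin 3) (P : MvPolynomial (Fin 3) ℝ) : MvPolynomial (Fin 3) ℝ :=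
  MvPolynomial.bind₁ (Function.update MvPolynomial.X i 0) P

lemma eval_rst (i : Fin 3) (P : MvPolynomial (Fin 3) ℝ) (p : Fin 3 → ℝ) :
    MvPolynomial.eval p (rst i P) = MvPolynomial.eval (Function.update p i 0) P := by
  unfold rst
  induction P using MvPolynomial.induction_on with
  | C a => simp
  | add P Q hP hQ => simp [hP, hQ]
  | mul_X P j hP =>
    simp only [map_mul, hP, MvPolynomial.bind₁_X_right, MvPolynomial.eval_X]
    by_cases h : j = i
    · subst h; simp
    · simp [h]

lemma pderiv_rst (i : Fin 3) (P : MvPolynomial (Fin 3) ℝ) :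
    MvPolynomial.pderiv i (rst i P) = 0 := by
  apply MvPolynomial.funext
  intro p
  have h := hd_poly (rst i P) p i (p i)
  simp only [eval_rst, Function.update_idem, Function.update_eq_self] at h
  rw [h.unique (hasDerivAt_const _ _)]; simp

/-- partial derivative along coordinate `i` at all points of `K` -/
def HasP (K : Set (Fin 3 → ℝ)) (i : Fin 3) (F G : (Fin 3 → ℝ) → ℝ) : Prop :=
  ∀ p ∈ K, HasDerivAt (fun s => F (Function.update p i s)) (G p) (p i)

lemma HasP.at {K : Set (Fin 3 → ℝ)} {i : Fin 3} {F G : (Fin 3 → ℝ) → ℝ} (h : HasP K i F G)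
    {p : Fin 3 → ℝ} {s : ℝ} (hp : Function.update p i s ∈ K) :
    HasDerivAt (fun s => F (Function.update p i s)) (G (Function.update p i s)) s := by
  simpa using h _ hp

lemma HasP.sub {K : Set (Fin 3 → ℝ)} {i : Fin 3} {F G F' G' : (Fin 3 → ℝ) → ℝ} (h : HasP K i F G)
    (h' : HasP K i F' G') : HasP K i (fun p => F p - F' p) (fun p => G p - G' p) :=
  fun p hp => (h p hp).sub (h' p hp)

lemma hasP_poly (K : Set (Fin 3 → ℝ)) (i : Fin 3) (P : MvPolynomial (Fin 3) ℝ) :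
    HasP K i (fun p => MvPolynomial.eval p P)
      (fun p => MvPolynomial.eval p (MvPolynomial.pderiv i P)) := fun p _ => by
  simpa using hd_poly P p i (p i)

lemma upd_mem {lo hi p : Fin 3 → ℝ} (hp : p ∈ Icc lo hi) {i : Fin 3} {s : ℝ}
    (hs : s ∈ Icc (lo i) (hi i)) : Function.update p i s ∈ Icc lo hi := by
  constructor
  · intro j
    by_cases h : j = i
    · subst h; simpa using hs.1
    · simpa [h] using hp.1 j
  · intro j
    by_cases h : j = i
    · subst h; simpa using hs.2
    · simpa [h] using hp.2 j

lemma mvt {q q' : ℝ → ℝ} {a b C : ℝ} (hd : ∀ s ∈ Icc a b, HasDerivAt q (q' s) s)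
    (hC : ∀ s ∈ Icc a b, |q' s| ≤ C) {x y : ℝ} (hx : x ∈ Icc a b) (hy : y ∈ Icc a b) :
    |q y - q x| ≤ C * |y - x| :=
  (convex_Icc a b).norm_image_sub_le_of_norm_hasDerivWithin_le
    (fun s hs => (hd s hs).hasDerivWithinAt) hC hx hy

lemma lip_deriv {q : ℝ → ℝ} {a b C d x : ℝ} (hab : a < b) (hx : x ∈ Icc a b)
    (hd : HasDerivAt q d x) (h : ∀ s ∈ Icc a b, |q s - q x| ≤ C * |s - x|) : |d| ≤ C := by
  have ht := hasDerivWithinAt_iff_tendsto_slope.1 (hd.hasDerivWithinAt (s := Icc a b))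
  have hne : (nhdsWithin x (Icc a b \ {x})).NeBot := by
    have := uniqueDiffOn_Icc hab x hx
    have := this.accPt
    rwa [accPt_principal_iff_nhdsWithin] at this
  refine le_of_tendsto ht.abs ?_
  filter_upwards [self_mem_nhdsWithin] with s hs
  have hsx : 0 < |s - x| := abs_pos.2 (sub_ne_zero.2 hs.2)
  rw [slope_def_field, abs_div, div_le_iff₀ hsx]
  exact h s hs.1

section peel
variable {lo hi : Fin 3 → ℝ} {R : ℝ}

lemma p_mem (hlt : ∀ i, lo i < hi i) (h0 : ∀ i, (0:ℝ) ∈ Icc (lo i) (hi i))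
    (hR : ∀ p ∈ Icc lo hi, ∀ i, |p i| ≤ R)
    (p) (hp : p ∈ Icc lo hi) (i : Fin 3) : p i ∈ Icc (lo i) (hi i) := ⟨hp.1 i, hp.2 i⟩

lemma peel0 (hlt : ∀ i, lo i < hi i) (h0 : ∀ i, (0:ℝ) ∈ Icc (lo i) (hi i))
    (hR : ∀ p ∈ Icc lo hi, ∀ i, |p i| ≤ R)
    {i : Fin 3} {d di : (Fin 3 → ℝ) → ℝ} (hi' : HasP (Icc lo hi) i d di) {ε : ℝ}
    (hε : 0 ≤ ε) (h1 : ∀ p ∈ Icc lo hi, |di p| ≤ ε)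
    (h2 : ∀ p ∈ Icc lo hi, p i = 0 → |d p| ≤ ε) : ∀ p ∈ Icc lo hi, |d p| ≤ (1 + R) * ε := by
  intro p hp
  have := mvt (q := fun s => d (Function.update p i s)) (fun s hs => hi'.at (upd_mem hp hs))
    (fun s hs => h1 _ (upd_mem hp hs)) (h0 i) (p_mem hlt h0 hR p hp i)
  have e := h2 (Function.update p i 0) (upd_mem hp (h0 i)) (by simp)
  simp only [Function.update_eq_self, sub_zero] at this
  have hb : ε * |p i| ≤ ε * R := mul_le_mul_of_nonneg_left (hR p hp i) hε
  have := abs_le.1 this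
  have := abs_le.1 e
  rw [abs_le]; constructor <;> linarith

lemma peelS (hlt : ∀ i, lo i < hi i) (h0 : ∀ i, (0:ℝ) ∈ Icc (lo i) (hi i))
    (hR : ∀ p ∈ Icc lo hi, ∀ i, |p i| ≤ R)
    {i j : Fin 3} (hij : j ≠ i) {d di dj dij : (Fin 3 → ℝ) → ℝ}
    (hdi : HasP (Icc lo hi) i d di) (hdj : HasP (Icc lo hi) j d dj)
    (hdij : HasP (Icc lo hi) j di dij) {ε : ℝ} (hε : 0 ≤ ε)
    (h1 : ∀ p ∈ Icc lo hi, |dij p| ≤ ε)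
    (h2 : ∀ p ∈ Icc lo hi, p i = 0 → |dj p| ≤ ε) : ∀ p ∈ Icc lo hi, |dj p| ≤ (1 + R) * ε := by
  intro p hp
  have hpi := p_mem hlt h0 hR p hp
  refine lip_deriv (hlt j) (hpi j) (hdj p hp) fun s hs => ?_
  have hps : Function.update p j s ∈ Icc lo hi := upd_mem hp hs
  have key : ∀ w ∈ Icc (lo i) (hi i), |di (Function.update (Function.update p j s) i w) -
      di (Function.update p i w)| ≤ ε * |s - p j| := by
    intro w hw
    have := mvt (q := fun s => di (Function.update (Function.update p i w) j s))
      (fun s hs => hdij.at (upd_mem (upd_mem hp hw) hs))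
      (fun s hs => h1 _ (upd_mem (upd_mem hp hw) hs)) (hpi j) hs
    have e4 : Function.update (Function.update p i w) j (p j) = Function.update p i w := by
      rw [Function.update_comm hij.symm]; simp
    simp only [e4] at this
    rw [Function.update_comm hij]
    exact this
  have a := mvt (q := fun w => d (Function.update (Function.update p j s) i w) -
      d (Function.update p i w)) (fun w hw => (hdi.at (upd_mem hps hw)).sub (hdi.at (upd_mem hp hw)))
    key (h0 i) (hpi i)
  have b := mvt (q := fun s => d (Function.update (Function.update p i 0) j s))
      (fun s hs => hdj.at (upd_mem (upd_mem hp (h0 i)) hs))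
      (fun s hs => h2 _ (upd_mem (upd_mem hp (h0 i)) hs) (by simp [hij.symm])) (hpi j) hs
  have e1 : Function.update (Function.update p j s) i (p i) = Function.update p j s := by
    rw [Function.update_comm hij]; simp
  have e2 : Function.update (Function.update p i 0) j (p j) = Function.update p i 0 := by
    rw [Function.update_comm hij.symm]; simp
  have e3 : Function.update (Function.update p i 0) j s = Function.update (Function.update p j s) i 0 :=
    Function.update_comm hij.symm _ _ _
  simp only [e1, e2, e3, Function.update_eq_self, sub_zero] at a b ⊢
  have hb : ε * |s - p j| * |p i| ≤ ε * |s - p j| * R :=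
    mul_le_mul_of_nonneg_left (hR p hp i) (by positivity)
  have := abs_le.1 a
  have := abs_le.1 b
  rw [abs_le]; constructor <;> linarith

lemma peel (hlt : ∀ i, lo i < hi i) (h0 : ∀ i, (0:ℝ) ∈ Icc (lo i) (hi i))
    (hR : ∀ p ∈ Icc lo hi, ∀ i, |p i| ≤ R)
    {i : Fin 3} {F G : (Fin 3 → ℝ) → ℝ} (hFG : HasP (Icc lo hi) i F G) {ε : ℝ} (hε : 0 ≤ ε)
    (P' P0 : MvPolynomial (Fin 3) ℝ)
    (hG : ∀ p ∈ Icc lo hi, |G p - MvPolynomial.eval p P'| ≤ ε)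
    (hF : ∀ p ∈ Icc lo hi, |F p - MvPolynomial.eval p P0| ≤ ε) :
    ∃ P : MvPolynomial (Fin 3) ℝ, MvPolynomial.pderiv i P = P' ∧
      (∀ p ∈ Icc lo hi, |F p - MvPolynomial.eval p P| ≤ (1 + R) * ε) ∧
      ∀ j ≠ i, ∀ Fj Gj, HasP (Icc lo hi) j F Fj → HasP (Icc lo hi) j G Gj →
        (∀ p ∈ Icc lo hi, |Gj p - MvPolynomial.eval p (MvPolynomial.pderiv j P')| ≤ ε) →
        (∀ p ∈ Icc lo hi, |Fj p - MvPolynomial.eval p (MvPolynomial.pderiv j P0)| ≤ ε) →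
        ∀ p ∈ Icc lo hi, |Fj p - MvPolynomial.eval p (MvPolynomial.pderiv j P)| ≤ (1 + R) * ε := by
  obtain ⟨Q, hQ⟩ := exists_antip P' i
  have hP' : MvPolynomial.pderiv i (Q + rst i (P0 - Q)) = P' := by
    rw [map_add, pderiv_rst, hQ, add_zero]
  have hface : ∀ p : Fin 3 → ℝ, p i = 0 → MvPolynomial.eval p (Q + rst i (P0 - Q)) =
      MvPolynomial.eval p P0 := by
    intro p hp
    have : Function.update p i 0 = p := by rw [← hp]; simp
    rw [map_add, eval_rst, this, map_sub]; ring
  set P := Q + rst i (P0 - Q) with hP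
  have hpi := hasP_poly (Icc lo hi) i P
  rw [hP'] at hpi
  refine ⟨P, hP', ?_, ?_⟩
  · refine peel0 hlt h0 hR (hFG.sub hpi) hε hG fun p hp hz => ?_
    rw [hface p hz]; exact hF p hp
  · intro j hij Fj Gj hFj hGj b1 b2
    refine peelS hlt h0 hR hij (hFG.sub hpi) (hFj.sub (hasP_poly _ j P))
      (hGj.sub (hasP_poly _ j P')) hε b1 fun p hp hz => ?_
    have : MvPolynomial.eval p (MvPolynomial.pderiv j P) =
        MvPolynomial.eval p (MvPolynomial.pderiv j P0) := by
      have u1 := hd_poly P p j (p j)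
      have u2 := hd_poly P0 p j (p j)
      have : (fun s => MvPolynomial.eval (Function.update p j s) P) =
          fun s => MvPolynomial.eval (Function.update p j s) P0 := by
        funext s
        exact hface _ (by simp [hij.symm, hz])
      rw [this] at u1
      simpa using u1.unique u2
    rw [this]; exact b2 p hp
end peel

lemma weier {K : Set (Fin 3 → ℝ)} (hK : IsCompact K) {F : (Fin 3 → ℝ) → ℝ} (hF : ContinuousOn F K)
    {ε : ℝ} (hε : 0 < ε) :
    ∃ P : MvPolynomial (Fin 3) ℝ, ∀ p ∈ K, |F p - MvPolynomial.eval p P| ≤ ε := by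
  have := isCompact_iff_compactSpace.1 hK
  let φ : MvPolynomial (Fin 3) ℝ →ₐ[ℝ] C(K, ℝ) :=
    MvPolynomial.aeval (fun i => (⟨fun p => p.1 i, (continuous_apply i).comp continuous_subtype_val⟩ : C(K, ℝ)))
  have hφ : ∀ P (p : K), φ P p = MvPolynomial.eval p.1 P := by
    intro P p
    induction P using MvPolynomial.induction_on with
    | C a => simp [φ]
    | add P Q hP hQ => simp [hP, hQ]
    | mul_X P j hP => rw [map_mul, ContinuousMap.mul_apply, hP]; simp [φ]
  have hsep : φ.range.SeparatesPoints := by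
    intro x y hxy
    obtain ⟨i, hi⟩ : ∃ i, x.1 i ≠ y.1 i := by
      by_contra! h
      exact hxy (Subtype.ext (funext h))
    refine ⟨_, ⟨φ (MvPolynomial.X i), ⟨_, rfl⟩, rfl⟩, ?_⟩
    simpa [hφ] using hi
  let Fc : C(K, ℝ) := ⟨K.domRestrict F, hF.domRestrict⟩
  have := ContinuousMap.continuousMap_mem_subalgebra_closure_of_separatesPoints φ.range hsep Fc
  obtain ⟨u, ⟨P, hP⟩, hu⟩ := Metric.mem_closure_iff.1 (show Fc ∈ closure (φ.range : Set C(K, ℝ)) from this) ε hε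
  refine ⟨P, fun p hp => ?_⟩
  have h1 := ((ContinuousMap.dist_lt_iff hε).1 hu ⟨p, hp⟩).le
  rw [← hP] at h1
  change dist (F p) (φ P ⟨p, hp⟩) ≤ ε at h1
  rwa [hφ, Real.dist_eq] at h1

section approx
variable {lo hi : Fin 3 → ℝ} {R : ℝ}

lemma stepT (hlt : ∀ i, lo i < hi i) (h0 : ∀ i, (0:ℝ) ∈ Icc (lo i) (hi i))
    (hR : ∀ p ∈ Icc lo hi, ∀ i, |p i| ≤ R) (hR0 : 0 ≤ R)
    {F Ft : (Fin 3 → ℝ) → ℝ} (h : HasP (Icc lo hi) 0 F Ft) (c : ContinuousOn F (Icc lo hi))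
    (ct : ContinuousOn Ft (Icc lo hi)) {ε : ℝ} (hε : 0 < ε) :
    ∃ P : MvPolynomial (Fin 3) ℝ, ∀ p ∈ Icc lo hi, |F p - MvPolynomial.eval p P| ≤ ε ∧
      |Ft p - MvPolynomial.eval p (MvPolynomial.pderiv 0 P)| ≤ ε := by
  have he : 0 < ε / (1 + R) := by positivity
  have hle : ε / (1 + R) ≤ ε := div_le_self hε.le (by linarith)
  have hmul : (1 + R) * (ε / (1 + R)) = ε := by field_simp
  obtain ⟨P', hP'⟩ := weier isCompact_Icc ct he
  obtain ⟨P0, hP0⟩ := weier isCompact_Icc c he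
  obtain ⟨P, e, b, -⟩ := peel hlt h0 hR h he.le P' P0 hP' hP0
  rw [hmul] at b
  exact ⟨P, fun p hp => ⟨b p hp, by rw [e]; exact (hP' p hp).trans hle⟩⟩

lemma stepX (hlt : ∀ i, lo i < hi i) (h0 : ∀ i, (0:ℝ) ∈ Icc (lo i) (hi i))
    (hR : ∀ p ∈ Icc lo hi, ∀ i, |p i| ≤ R) (hR0 : 0 ≤ R)
    {F Ft Fx Ftx : (Fin 3 → ℝ) → ℝ} (h : HasP (Icc lo hi) 0 F Ft)
    (hx : HasP (Icc lo hi) 1 F Fx) (hxt : HasP (Icc lo hi) 0 Fx Ftx)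
    (c : ContinuousOn F (Icc lo hi)) (ct : ContinuousOn Ft (Icc lo hi))
    (cx : ContinuousOn Fx (Icc lo hi)) (ctx : ContinuousOn Ftx (Icc lo hi)) {ε : ℝ} (hε : 0 < ε) :
    ∃ P : MvPolynomial (Fin 3) ℝ, ∀ p ∈ Icc lo hi, |F p - MvPolynomial.eval p P| ≤ ε ∧
      |Ft p - MvPolynomial.eval p (MvPolynomial.pderiv 0 P)| ≤ ε ∧
      |Fx p - MvPolynomial.eval p (MvPolynomial.pderiv 1 P)| ≤ ε := by
  have he : 0 < ε / (1 + R) := by positivity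
  have hle : ε / (1 + R) ≤ ε := div_le_self hε.le (by linarith)
  have hmul : (1 + R) * (ε / (1 + R)) = ε := by field_simp
  obtain ⟨P', hP'⟩ := stepT hlt h0 hR hR0 hxt cx ctx he
  obtain ⟨P0, hP0⟩ := stepT hlt h0 hR hR0 h c ct he
  obtain ⟨P, e, b, bj⟩ := peel hlt h0 hR hx he.le P' P0 (fun p hp => (hP' p hp).1)
    (fun p hp => (hP0 p hp).1)
  have bt := bj 0 (by decide) Ft Ftx h hxt (fun p hp => (hP' p hp).2) (fun p hp => (hP0 p hp).2)
  rw [hmul] at b bt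
  exact ⟨P, fun p hp => ⟨b p hp, bt p hp, by rw [e]; exact ((hP' p hp).1).trans hle⟩⟩

lemma stepV (hlt : ∀ i, lo i < hi i) (h0 : ∀ i, (0:ℝ) ∈ Icc (lo i) (hi i))
    (hR : ∀ p ∈ Icc lo hi, ∀ i, |p i| ≤ R) (hR0 : 0 ≤ R)
    (F Ft Fx Ftx : ℕ → (Fin 3 → ℝ) → ℝ) (h : ∀ c ≤ 2, HasP (Icc lo hi) 0 (F c) (Ft c))
    (hx : ∀ c ≤ 2, HasP (Icc lo hi) 1 (F c) (Fx c))
    (hxt : ∀ c ≤ 2, HasP (Icc lo hi) 0 (Fx c) (Ftx c))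
    (hv : ∀ c ≤ 1, HasP (Icc lo hi) 2 (F c) (F (c+1)))
    (c : ∀ c ≤ 2, ContinuousOn (F c) (Icc lo hi)) (ct : ∀ c ≤ 2, ContinuousOn (Ft c) (Icc lo hi))
    (cx : ∀ c ≤ 2, ContinuousOn (Fx c) (Icc lo hi))
    (ctx : ∀ c ≤ 2, ContinuousOn (Ftx c) (Icc lo hi)) {ε : ℝ} (hε : 0 < ε) :
    ∃ P : MvPolynomial (Fin 3) ℝ, ∀ p ∈ Icc lo hi, ∀ i,
      |![F 0 p, Ft 0 p, Fx 0 p, F 1 p, F 2 p] i - pj P p i| ≤ ε := by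
  have he : 0 < ε / (1 + R) := by positivity
  have hle : ε / (1 + R) ≤ ε := div_le_self hε.le (by linarith)
  have hmul : (1 + R) * (ε / (1 + R)) = ε := by field_simp
  set ε1 := ε / (1 + R)
  have he' : 0 < ε1 / (1 + R) := by positivity
  have hle' : ε1 / (1 + R) ≤ ε1 := div_le_self he.le (by linarith)
  have hmul' : (1 + R) * (ε1 / (1 + R)) = ε1 := by field_simp
  have A := fun k (hk : k ≤ 2) => stepX hlt h0 hR hR0 (h k hk) (hx k hk) (hxt k hk) (c k hk)
    (ct k hk) (cx k hk) (ctx k hk) he'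
  obtain ⟨P2, hP2⟩ := A 2 le_rfl
  obtain ⟨P1, hP1⟩ := A 1 (by norm_num)
  obtain ⟨P0, hP0⟩ := A 0 (by norm_num)
  obtain ⟨Q, eQ, b, bj⟩ := peel hlt h0 hR (hv 1 le_rfl) he'.le P2 P1 (fun p hp => (hP2 p hp).1)
    (fun p hp => (hP1 p hp).1)
  have b0 := bj 0 (by decide) _ _ (h 1 (by norm_num)) (h 2 le_rfl) (fun p hp => (hP2 p hp).2.1)
    (fun p hp => (hP1 p hp).2.1)
  have b1 := bj 1 (by decide) _ _ (hx 1 (by norm_num)) (hx 2 le_rfl) (fun p hp => (hP2 p hp).2.2)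
    (fun p hp => (hP1 p hp).2.2)
  rw [hmul'] at b b0 b1
  obtain ⟨P, eP, d, dj⟩ := peel hlt h0 hR (hv 0 (by norm_num)) he.le Q P0 b
    (fun p hp => (hP0 p hp).1.trans hle')
  have d0 := dj 0 (by decide) _ _ (h 0 (by norm_num)) (h 1 (by norm_num)) b0
    (fun p hp => (hP0 p hp).2.1.trans hle')
  have d1 := dj 1 (by decide) _ _ (hx 0 (by norm_num)) (hx 1 (by norm_num)) b1
    (fun p hp => (hP0 p hp).2.2.trans hle')
  rw [hmul] at d d0 d1
  refine ⟨P, fun p hp i => ?_⟩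
  unfold pj
  rw [eP, eQ]
  fin_cases i
  · exact d p hp
  · exact d0 p hp
  · exact d1 p hp
  · exact (b p hp).trans hle
  · exact ((hP2 p hp).1.trans hle').trans hle
end approx


/-- The one-hidden-layer network. -/
noncomputable def net (g : ℝ → ℝ) {m : ℕ} (c θ : Fin m → ℝ) (w : Fin m → ℝ × ℝ × ℝ) :
    ℝ → ℝ → ℝ → ℝ := fun t x v =>
  ∑ i, c i * g ((w i).1 * t + (w i).2.1 * x + (w i).2.2 * v + θ i)

section net
variable {g : ℝ → ℝ} {m : ℕ} (c θ : Fin m → ℝ) (w : Fin m → ℝ × ℝ × ℝ)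

lemma lin_deriv (a b s : ℝ) : HasDerivAt (fun s => a * s + b) a s := by
  simpa using ((hasDerivAt_id s).const_mul a).add_const b

lemma net_dt (hg : Differentiable ℝ g) (t x v : ℝ) :
    HasDerivAt (fun s => net g c θ w s x v)
      (∑ i, c i * ((w i).1 * deriv g ((w i).1 * t + (w i).2.1 * x + (w i).2.2 * v + θ i))) t := by
  unfold net
  refine HasDerivAt.fun_sum fun i _ => HasDerivAt.const_mul _ ?_
  have h := (hg ((w i).1 * t + (w i).2.1 * x + (w i).2.2 * v + θ i)).hasDerivAt
  have h1 : HasDerivAt (fun s => (w i).1 * s + (w i).2.1 * x + (w i).2.2 * v + θ i) (w i).1 t :=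
    (((lin_deriv (w i).1 ((w i).2.1 * x) t).add_const ((w i).2.2 * v))).add_const (θ i)
  exact (h.comp t h1).congr_deriv (mul_comm _ _)

lemma net_dx (hg : Differentiable ℝ g) (t x v : ℝ) :
    HasDerivAt (fun s => net g c θ w t s v)
      (∑ i, c i * ((w i).2.1 * deriv g ((w i).1 * t + (w i).2.1 * x + (w i).2.2 * v + θ i))) x := by
  unfold net
  refine HasDerivAt.fun_sum fun i _ => HasDerivAt.const_mul _ ?_
  have h := (hg ((w i).1 * t + (w i).2.1 * x + (w i).2.2 * v + θ i)).hasDerivAt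
  have h1 : HasDerivAt (fun s => (w i).1 * t + (w i).2.1 * s + (w i).2.2 * v + θ i) (w i).2.1 x := by
    have := lin_deriv (w i).2.1 ((w i).1 * t + (w i).2.2 * v + θ i) x
    refine this.congr_of_eventuallyEq (Eventually.of_forall fun s => ?_)
    ring
  exact (h.comp x h1).congr_deriv (mul_comm _ _)

lemma net_dv (hg : Differentiable ℝ g) (t x v : ℝ) :
    HasDerivAt (fun s => net g c θ w t x s)
      (net (deriv g) (fun i => c i * (w i).2.2) θ w t x v) v := by
  unfold net
  refine HasDerivAt.fun_sum fun i _ => ?_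
  have h := (hg ((w i).1 * t + (w i).2.1 * x + (w i).2.2 * v + θ i)).hasDerivAt
  have h1 : HasDerivAt (fun s => (w i).1 * t + (w i).2.1 * x + (w i).2.2 * s + θ i) (w i).2.2 v := by
    have := lin_deriv (w i).2.2 ((w i).1 * t + (w i).2.1 * x + θ i) v
    refine this.congr_of_eventuallyEq (Eventually.of_forall fun s => ?_)
    ring
  exact ((h.comp v h1).const_mul (c i)).congr_deriv (by ring)
end net

lemma jet_approx {T : ℝ} (hT : 0 < T) {f : ℝ → ℝ → ℝ → ℝ}
    (hreg : ∃ U : Set (ℝ × ℝ × ℝ), IsOpen U ∧ Kset T ⊆ U ∧ IsC112On f U)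
    {g : ℝ → ℝ} (hg : ContDiff ℝ 3 g)
    (hn : ¬ ∃ p : Polynomial ℝ, ∀ y : ℝ, g y = Polynomial.eval y p) {ε : ℝ} (hε : 0 < ε) :
    ∃ (m : ℕ) (c θ : Fin m → ℝ) (w : Fin m → ℝ × ℝ × ℝ),
      ∀ t ∈ Icc (0:ℝ) T, ∀ x ∈ Icc (-1:ℝ) 1, ∀ v ∈ Icc (-10:ℝ) 10,
        |net g c θ w t x v - f t x v| ≤ ε ∧
        |Dt (net g c θ w) t x v - Dt f t x v| ≤ ε ∧
        |Dx (net g c θ w) t x v - Dx f t x v| ≤ ε ∧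
        |Dv (net g c θ w) t x v - Dv f t x v| ≤ ε ∧
        |Dv (Dv (net g c θ w)) t x v - Dv (Dv f) t x v| ≤ ε := by
  obtain ⟨U, -, hKU, hc, hdt, hdx, hdv⟩ := hreg
  set lo : Fin 3 → ℝ := ![0, -1, -10] with hlo
  set hi : Fin 3 → ℝ := ![T, 1, 10] with hhi
  have hmemK : ∀ p ∈ Icc lo hi, ((p 0, p 1, p 2) : ℝ × ℝ × ℝ) ∈ U := by
    intro p hp
    refine hKU ⟨⟨?_, ?_⟩, ⟨?_, ?_⟩, ⟨?_, ?_⟩⟩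
    · simpa [hlo] using hp.1 0
    · simpa [hhi] using hp.2 0
    · simpa [hlo] using hp.1 1
    · simpa [hhi] using hp.2 1
    · simpa [hlo] using hp.1 2
    · simpa [hhi] using hp.2 2
  have hlt : ∀ i, lo i < hi i := by
    intro i; fin_cases i
    · simpa [hlo, hhi] using hT
    · simp [hlo, hhi]
    · simp [hlo, hhi]
  have h0 : ∀ i, (0:ℝ) ∈ Icc (lo i) (hi i) := by
    intro i; fin_cases i
    · simpa [hlo, hhi] using hT.le
    · simp [hlo, hhi]
    · simp [hlo, hhi]
  have hR : ∀ p ∈ Icc lo hi, ∀ i, |p i| ≤ T + 10 := by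
    intro p hp i
    have a := hp.1 i
    have b := hp.2 i
    rw [abs_le]
    fin_cases i <;> simp [hlo, hhi] at a b ⊢ <;> constructor <;> linarith
  have hcont : ∀ a b k, a ≤ 1 → b ≤ 1 → k ≤ 2 →
      ContinuousOn (fun p : Fin 3 → ℝ => mixedD a b k f (p 0) (p 1) (p 2)) (Icc lo hi) := by
    intro a b k ha hb hk p hp
    have h1 := hc a b k ha hb hk _ (hmemK p hp)
    have h2 : ContinuousAt (fun p : Fin 3 → ℝ => ((p 0, p 1, p 2) : ℝ × ℝ × ℝ)) p := by fun_prop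
    exact (ContinuousAt.comp (f := fun p : Fin 3 → ℝ => ((p 0, p 1, p 2) : ℝ × ℝ × ℝ)) h1 h2).continuousWithinAt
  have hPt : ∀ b k, b ≤ 1 → k ≤ 2 →
      HasP (Icc lo hi) 0 (fun p : Fin 3 → ℝ => mixedD 0 b k f (p 0) (p 1) (p 2))
        (fun p : Fin 3 → ℝ => mixedD 1 b k f (p 0) (p 1) (p 2)) := by
    intro b k hb hk p hp
    have := (hdt b k hb hk _ (hmemK p hp)).hasDerivAt
    exact this.congr_of_eventuallyEq (Eventually.of_forall fun s => by simp)
  have hPx : ∀ k, k ≤ 2 →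
      HasP (Icc lo hi) 1 (fun p : Fin 3 → ℝ => mixedD 0 0 k f (p 0) (p 1) (p 2))
        (fun p : Fin 3 → ℝ => mixedD 0 1 k f (p 0) (p 1) (p 2)) := by
    intro k hk p hp
    have := (hdx k hk _ (hmemK p hp)).hasDerivAt
    exact this.congr_of_eventuallyEq (Eventually.of_forall fun s => by simp)
  have hPv : ∀ k, k ≤ 1 →
      HasP (Icc lo hi) 2 (fun p : Fin 3 → ℝ => mixedD 0 0 k f (p 0) (p 1) (p 2))
        (fun p : Fin 3 → ℝ => mixedD 0 0 (k+1) f (p 0) (p 1) (p 2)) := by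
    intro k hk p hp
    have := (hdv k hk _ (hmemK p hp)).hasDerivAt
    have e : mixedD 0 0 (k+1) f = Dv (mixedD 0 0 k f) := by
      simp only [mixedD, Function.iterate_zero, id, Function.iterate_succ_apply']
    simp only [e]
    exact this.congr_of_eventuallyEq (Eventually.of_forall fun s => by simp)
  obtain ⟨P, hP⟩ := stepV hlt h0 hR (by linarith)
    (fun k p => mixedD 0 0 k f (p 0) (p 1) (p 2)) (fun k p => mixedD 1 0 k f (p 0) (p 1) (p 2))
    (fun k p => mixedD 0 1 k f (p 0) (p 1) (p 2)) (fun k p => mixedD 1 1 k f (p 0) (p 1) (p 2))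
    (fun k hk => hPt 0 k (by norm_num) hk) hPx (fun k hk => hPt 1 k le_rfl hk) hPv
    (fun k hk => hcont 0 0 k (by norm_num) (by norm_num) hk)
    (fun k hk => hcont 1 0 k (by norm_num) (by norm_num) hk)
    (fun k hk => hcont 0 1 k (by norm_num) (by norm_num) hk)
    (fun k hk => hcont 1 1 k (by norm_num) (by norm_num) hk) (half_pos hε)
  have hg2 : ContDiff ℝ 2 g := hg.of_le (by norm_num)
  have hL : P ∈ LL g (Icc lo hi) := by
    rw [LL_top hg2 hn (Icc lo hi) (T + 10) hR]; trivial
  obtain ⟨N, hN, hNP⟩ := hL (ε / 2) (half_pos hε)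
  obtain ⟨m, c, q, hq⟩ := (Submodule.mem_span_set' (R := ℝ)).1 hN
  choose r hr using fun i => (q i).2
  let w : Fin m → ℝ × ℝ × ℝ := fun i => ((r i).1 0, (r i).1 1, (r i).1 2)
  let θ : Fin m → ℝ := fun i => (r i).2
  have hgd : Differentiable ℝ g := hg.differentiable (by norm_num)
  have hgd' : Differentiable ℝ (deriv g) := (c2_facts hg2).1.differentiable (by norm_num)
  refine ⟨m, c, θ, w, fun t ht x hx v hv => ?_⟩
  have hp : (![t, x, v] : Fin 3 → ℝ) ∈ Icc lo hi := by
    constructor <;> intro i <;> fin_cases i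
    · simpa [hlo] using ht.1
    · simpa [hlo] using hx.1
    · simpa [hlo] using hv.1
    · simpa [hhi] using ht.2
    · simpa [hhi] using hx.2
    · simpa [hhi] using hv.2
  have htot : ∀ i, |N ![t,x,v] i - ![f t x v, Dt f t x v, Dx f t x v, Dv f t x v, Dv (Dv f) t x v] i| ≤ ε := by
    intro i
    have a := abs_le.1 (hP _ hp i)
    have b := abs_le.1 (hNP _ hp i)
    have e : ![f t x v, Dt f t x v, Dx f t x v, Dv f t x v, Dv (Dv f) t x v] i =
      ![mixedD 0 0 0 f t x v, mixedD 1 0 0 f t x v, mixedD 0 1 0 f t x v, mixedD 0 0 1 f t x v,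
        mixedD 0 0 2 f t x v] i := rfl
    rw [e]
    simp only [Matrix.cons_val_zero, Matrix.cons_val_one, Matrix.cons_val] at a
    rw [abs_le]; constructor <;> linarith
  have hNs : ∀ i, N ![t,x,v] i = ∑ j, c j * nj g (r j) ![t,x,v] i := by
    intro i
    rw [← hq]
    simp only [Finset.sum_apply, Pi.smul_apply, smul_eq_mul]
    exact Finset.sum_congr rfl fun j _ => by rw [← hr j]
  have eDv : Dv (net g c θ w) = net (deriv g) (fun i => c i * (w i).2.2) θ w := by
    funext t x v; exact (net_dv c θ w hgd t x v).deriv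
  have eDvv : Dv (net (deriv g) (fun i => c i * (w i).2.2) θ w) =
      net (deriv (deriv g)) (fun i => c i * (w i).2.2 * (w i).2.2) θ w := by
    funext t x v; exact (net_dv _ θ w hgd' t x v).deriv
  have e1 : Dt (net g c θ w) t x v = _ := (net_dt c θ w hgd t x v).deriv
  have e2 : Dx (net g c θ w) t x v = _ := (net_dx c θ w hgd t x v).deriv
  simp only [hNs] at htot
  refine ⟨htot 0, ?_, ?_, ?_, ?_⟩
  · rw [e1]; exact htot 1
  · rw [e2]; exact htot 2
  · rw [eDv]; convert htot 3 using 2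
    simp only [net, nj, w, θ, Matrix.cons_val, Matrix.cons_val_zero, Matrix.cons_val_one]
    congr 1
    exact Finset.sum_congr rfl fun j _ => by ring
  · rw [eDv, eDvv]; convert htot 4 using 2
    simp only [net, nj, w, θ, Matrix.cons_val, Matrix.cons_val_zero, Matrix.cons_val_one]
    congr 1
    exact Finset.sum_congr rfl fun j _ => by ring

lemma ae_ne (a : ℝ) : ∀ᵐ x : ℝ, x ≠ a := by
  simp [ae_iff]

lemma Dv_mul (u : ℝ → ℝ → ℝ → ℝ) (t x v : ℝ) (h : DifferentiableAt ℝ (fun w => u t x w) v) :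
    Dv (fun t' x' w => w * u t' x' w) t x v = u t x v + v * Dv u t x v := by
  have := ((hasDerivAt_id v).mul h.hasDerivAt).deriv
  simp only [id, one_mul] at this
  exact this

lemma loss_bound (σ β T : ℝ) (hσ : 0 < σ) (hβ : 0 ≤ β) (hT : 0 < T)
    (f : ℝ → ℝ → ℝ → ℝ) (f0 : ℝ → ℝ → ℝ)
    (hf : ∀ t ∈ Icc (0:ℝ) T, ∀ x ∈ Icc (-1:ℝ) 1, ∀ v ∈ Icc (-10:ℝ) 10,
      DifferentiableAt ℝ (fun w => f t x w) v)
    (hPDE : ∀ t ∈ Set.Ioo (0 : ℝ) T, ∀ x ∈ Set.Ioo (-1 : ℝ) 1, ∀ v : ℝ,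
      Dt f t x v + v * Dx f t x v
        = σ * Dv (Dv f) t x v + β * Dv (fun t' x' w => w * f t' x' w) t x v)
    (hIC : ∀ x ∈ Set.Ioo (-1 : ℝ) 1, ∀ v : ℝ, f 0 x v = f0 x v)
    (hBC : ∀ t ∈ Set.Icc (0 : ℝ) T,
      (∀ v : ℝ, v < 0 → f t 1 v = f t 1 (-v)) ∧ (∀ v : ℝ, 0 < v → f t (-1) v = f t (-1) (-v)))
    (u : ℝ → ℝ → ℝ → ℝ) (hu : ∀ t x v, DifferentiableAt ℝ (fun w => u t x w) v) (ε : ℝ)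
    (h : ∀ t ∈ Icc (0:ℝ) T, ∀ x ∈ Icc (-1:ℝ) 1, ∀ v ∈ Icc (-10:ℝ) 10,
        |u t x v - f t x v| ≤ ε ∧
        |Dt u t x v - Dt f t x v| ≤ ε ∧
        |Dx u t x v - Dx f t x v| ≤ ε ∧
        |Dv u t x v - Dv f t x v| ≤ ε ∧
        |Dv (Dv u) t x v - Dv (Dv f) t x v| ≤ ε) :
    ‖LossGE σ β T u + LossIC f0 u + LossBCspec T u‖ ≤
      ((11 + σ + 11 * β) ^ 2 * 40 * T + 40 + 80 * T) * ε ^ 2 := by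
  have hε : 0 ≤ ε := (abs_nonneg _).trans (h 0 ⟨le_rfl, hT.le⟩ 0 (by norm_num) 0 (by norm_num)).1
  have sq_b : ∀ a b : ℝ, |a| ≤ b → ‖a ^ 2‖ ≤ b ^ 2 := by
    intro a b hab
    rw [Real.norm_eq_abs, abs_pow]
    exact pow_le_pow_left₀ (abs_nonneg _) hab 2
  -- governing equation
  have hGE : ‖LossGE σ β T u‖ ≤ ((11 + σ + 11 * β) * ε) ^ 2 * |(10:ℝ) - (-10)| * |(1:ℝ) - (-1)| * |T - 0| := by
    unfold LossGE
    apply intervalIntegral.norm_integral_le_of_norm_le_const_ae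
    filter_upwards [ae_ne T] with t htT ht
    rw [uIoc_of_le hT.le] at ht
    have ht' : t ∈ Ioo 0 T := ⟨ht.1, lt_of_le_of_ne ht.2 htT⟩
    apply intervalIntegral.norm_integral_le_of_norm_le_const_ae
    filter_upwards [ae_ne 1] with x hx1 hx
    rw [uIoc_of_le (by norm_num)] at hx
    have hx' : x ∈ Ioo (-1:ℝ) 1 := ⟨hx.1, lt_of_le_of_ne hx.2 hx1⟩
    apply intervalIntegral.norm_integral_le_of_norm_le_const
    intro v hv
    rw [uIoc_of_le (by norm_num)] at hv
    have hv' : v ∈ Icc (-10:ℝ) 10 := ⟨hv.1.le, hv.2⟩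
    obtain ⟨b0, bt, bx, bv, bvv⟩ := h t ⟨ht.1.le, ht.2⟩ x ⟨hx.1.le, hx.2⟩ v hv'
    have hp := hPDE t ht' x hx' v
    rw [Dv_mul f t x v (hf t ⟨ht.1.le, ht.2⟩ x ⟨hx.1.le, hx.2⟩ v hv')] at hp
    apply sq_b
    unfold FPresidual
    rw [Dv_mul u t x v (hu t x v)]
    have hv10 : |v| ≤ 10 := abs_le.2 hv'
    have e : Dt u t x v + v * Dx u t x v - σ * Dv (Dv u) t x v - β * (u t x v + v * Dv u t x v)
      = (Dt u t x v - Dt f t x v) + v * (Dx u t x v - Dx f t x v)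
        + -(σ * (Dv (Dv u) t x v - Dv (Dv f) t x v)) +
        -(β * ((u t x v - f t x v) + v * (Dv u t x v - Dv f t x v))) := by
      linear_combination hp
    have m1 : ∀ a : ℝ, |a| ≤ ε → |v * a| ≤ 10 * ε := fun a ha => by
      rw [abs_mul]; exact mul_le_mul hv10 ha (abs_nonneg _) (by norm_num)
    have m2 : |σ * (Dv (Dv u) t x v - Dv (Dv f) t x v)| ≤ σ * ε := by
      rw [abs_mul, abs_of_pos hσ]; exact mul_le_mul_of_nonneg_left bvv hσ.le
    have m3 : |β * ((u t x v - f t x v) + v * (Dv u t x v - Dv f t x v))| ≤ β * (11 * ε) := by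
      rw [abs_mul, abs_of_nonneg hβ]
      refine mul_le_mul_of_nonneg_left ((abs_add_le _ _).trans ?_) hβ
      linarith [m1 _ bv]
    rw [e]
    refine (abs_add_le _ _).trans ?_
    rw [abs_neg]
    have := abs_add_three (Dt u t x v - Dt f t x v) (v * (Dx u t x v - Dx f t x v))
      (-(σ * (Dv (Dv u) t x v - Dv (Dv f) t x v)))
    rw [abs_neg] at this
    linarith [m1 _ bx]
  have hICb : ‖LossIC f0 u‖ ≤ ε ^ 2 * |(10:ℝ) - (-10)| * |(1:ℝ) - (-1)| := by
    unfold LossIC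
    apply intervalIntegral.norm_integral_le_of_norm_le_const_ae
    filter_upwards [ae_ne 1] with x hx1 hx
    rw [uIoc_of_le (by norm_num)] at hx
    have hx' : x ∈ Ioo (-1:ℝ) 1 := ⟨hx.1, lt_of_le_of_ne hx.2 hx1⟩
    apply intervalIntegral.norm_integral_le_of_norm_le_const
    intro v hv
    rw [uIoc_of_le (by norm_num)] at hv
    apply sq_b
    rw [← hIC x hx' v]
    exact (h 0 ⟨le_rfl, hT.le⟩ x ⟨hx.1.le, hx.2⟩ v ⟨hv.1.le, hv.2⟩).1
  have hBCb : ‖LossBCspec T u‖ ≤ ((2 * ε) ^ 2 * |(0:ℝ) - (-10)| + (2 * ε) ^ 2 * |(10:ℝ) - 0|) * |T - 0| := by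
    unfold LossBCspec
    apply intervalIntegral.norm_integral_le_of_norm_le_const
    intro t ht
    rw [uIoc_of_le hT.le] at ht
    have ht' : t ∈ Icc 0 T := ⟨ht.1.le, ht.2⟩
    refine (norm_add_le _ _).trans (add_le_add ?_ ?_)
    · apply intervalIntegral.norm_integral_le_of_norm_le_const
      intro v hv
      rw [uIoc_of_le (by norm_num)] at hv
      apply sq_b
      rcases hv.2.lt_or_eq with hv0 | hv0
      · have e := (hBC t ht').1 v hv0
        have a := abs_le.1 (h t ht' 1 (by norm_num) v ⟨hv.1.le, by linarith⟩).1
        have b := abs_le.1 (h t ht' 1 (by norm_num) (-v) ⟨by linarith, by linarith [hv.1]⟩).1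
        rw [abs_le]; constructor <;> linarith
      · rw [hv0]; simpa using hε
    · apply intervalIntegral.norm_integral_le_of_norm_le_const
      intro v hv
      rw [uIoc_of_le (by norm_num)] at hv
      apply sq_b
      have e := (hBC t ht').2 v hv.1
      have a := abs_le.1 (h t ht' (-1) (by norm_num) v ⟨by linarith [hv.1], hv.2⟩).1
      have b := abs_le.1 (h t ht' (-1) (by norm_num) (-v) ⟨by linarith [hv.2], by linarith [hv.1]⟩).1
      rw [abs_le]; constructor <;> linarith
  have r1 : |(10:ℝ) - (-10)| = 20 := by norm_num
  have r2 : |(1:ℝ) - (-1)| = 2 := by norm_num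
  have r3 : |(0:ℝ) - (-10)| = 10 := by norm_num
  have r4 : |(10:ℝ) - 0| = 10 := by norm_num
  have r5 : |T - 0| = T := by rw [sub_zero, abs_of_pos hT]
  rw [r1, r2, r5] at hGE
  rw [r1, r2] at hICb
  rw [r3, r4, r5] at hBCb
  refine (norm_add₃_le).trans ?_
  refine (add_le_add (add_le_add hGE hICb) hBCb).trans (le_of_eq ?_)
  ring

/-- If the 1D kinetic Fokker–Planck equation with specular reflection boundary
condition admits a solution of class C^{(1,1,2)} on a neighborhood of K = [0,T]×[−1,1]×[−10,10],
and `σbar` is a non-polynomial C³ activation function, then there is a sequence of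
one-hidden-layer neural networks whose total loss tends to 0. -/
theorem statement1 (σ β T : ℝ) (hσ : 0 < σ) (hβ : 0 ≤ β) (hT : 0 < T)
    (f : ℝ → ℝ → ℝ → ℝ) (f0 : ℝ → ℝ → ℝ)
    (hreg : ∃ U : Set (ℝ × ℝ × ℝ), IsOpen U ∧ Kset T ⊆ U ∧ IsC112On f U)
    (hPDE : ∀ t ∈ Set.Ioo (0 : ℝ) T, ∀ x ∈ Set.Ioo (-1 : ℝ) 1, ∀ v : ℝ,
      Dt f t x v + v * Dx f t x v
        = σ * Dv (Dv f) t x v + β * Dv (fun t' x' w => w * f t' x' w) t x v)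
    (hIC : ∀ x ∈ Set.Ioo (-1 : ℝ) 1, ∀ v : ℝ, f 0 x v = f0 x v)
    (hBC : ∀ t ∈ Set.Icc (0 : ℝ) T,
      (∀ v : ℝ, v < 0 → f t 1 v = f t 1 (-v)) ∧ (∀ v : ℝ, 0 < v → f t (-1) v = f t (-1) (-v)))
    (σbar : ℝ → ℝ) (hσbar : ContDiff ℝ 3 σbar)
    (hnonpoly : ¬ ∃ p : Polynomial ℝ, ∀ y : ℝ, σbar y = Polynomial.eval y p) :
    ∃ (m : ℕ → ℕ) (c θ : (j : ℕ) → Fin (m j) → ℝ) (w : (j : ℕ) → Fin (m j) → ℝ × ℝ × ℝ),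
      Filter.Tendsto (fun j : ℕ =>
        LossGE σ β T (fun t x v =>
          ∑ i, c j i * σbar ((w j i).1 * t + (w j i).2.1 * x + (w j i).2.2 * v + θ j i)) +
        LossIC f0 (fun t x v =>
          ∑ i, c j i * σbar ((w j i).1 * t + (w j i).2.1 * x + (w j i).2.2 * v + θ j i)) +
        LossBCspec T (fun t x v =>
          ∑ i, c j i * σbar ((w j i).1 * t + (w j i).2.1 * x + (w j i).2.2 * v + θ j i)))
        Filter.atTop (nhds 0) := by
  have hε : ∀ j : ℕ, (0:ℝ) < 1 / ((j:ℝ) + 1) := fun j => by positivity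
  choose m c θ w h using fun j => jet_approx hT hreg hσbar hnonpoly (hε j)
  have hf : ∀ t ∈ Icc (0:ℝ) T, ∀ x ∈ Icc (-1:ℝ) 1, ∀ v ∈ Icc (-10:ℝ) 10,
      DifferentiableAt ℝ (fun w => f t x w) v := by
    obtain ⟨U, -, hKU, hc⟩ := hreg
    intro t ht x hx v hv
    exact hc.2.2.2 0 (by norm_num) (t, x, v) (hKU ⟨ht, hx, hv⟩)
  refine ⟨m, c, θ, w, ?_⟩
  refine squeeze_zero_norm (fun j => loss_bound σ β T hσ hβ hT f f0 hf hPDE hIC hBC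
    (net σbar (c j) (θ j) (w j)) (fun t x v => (net_dv (c j) (θ j) (w j)
      (hσbar.differentiable (by norm_num)) t x v).differentiableAt) _ (h j)) ?_
  have ht := (tendsto_one_div_add_atTop_nhds_zero_nat (𝕜 := ℝ)).pow 2
  simpa using ht.const_mul ((11 + σ + 11 * β) ^ 2 * 40 * T + 40 + 80 * T)
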